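/- For every δ > 0 there exist a smooth nonnegative function H : ℝ² → ℝ whose support is contained in the open disc of radius √(2+2δ) centered at the origin, with maximum value less than π + δ, and a Hamiltonian flow φ : ℝ × ℝ² → ℝ² of H, such that for every t ∈ [0,1] the image φᵗ(B²(1)) is contained in the closed disc B²(√((1+t)(1+δ/π))), and φ¹(B²(1)) ∩ B²(1) = ∅ (where φᵗ = φ(t, ·)). -/

import Mathlib

noncomputable section

/-- The closed disc of radius `R` centered at the origin in `ℝ²` (Euclidean metric). -/
def closedDisc (R : ℝ) : Set (ℝ × ℝ) := {p | p.1 ^ 2 + p.2 ^ 2 ≤ R ^ 2}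

/-- The Hamiltonian vector field of `H : ℝ² → ℝ` with the convention `i_{X_H} ω₀ = −dH`
for `ω₀ = dx ∧ dy`, namely `X_H = (−∂H/∂y, ∂H/∂x)`. -/
def hamVF (H : ℝ × ℝ → ℝ) (p : ℝ × ℝ) : ℝ × ℝ :=
  (-(fderiv ℝ H p (0, 1)), fderiv ℝ H p (1, 0))

/-- `φ : ℝ × ℝ² → ℝ²` (curried) is a Hamiltonian flow of `H`: `φ(0,p) = p` and
`∂φ/∂t (t,p) = X_H(φ(t,p))` for all `t` and `p`. -/
def IsHamFlow (H : ℝ × ℝ → ℝ) (φ : ℝ → ℝ × ℝ → ℝ × ℝ) : Prop :=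
  (∀ p, φ 0 p = p) ∧ ∀ p t, HasDerivAt (fun s => φ s p) (hamVF H (φ t p)) t

open Set Filter Topology
open scoped ContDiff NNReal Manifold

/-- A bounded Lipschitz vector field on a Banach space is complete. -/
theorem exists_global_integralCurve {E : Type*} [NormedAddCommGroup E] [NormedSpace ℝ E]
    [CompleteSpace E] {v : E → E} {K L : ℝ≥0} (hv : LipschitzWith K v) (hL : ∀ x, ‖v x‖ ≤ L)
    (x : E) : ∃ γ : ℝ → E, γ 0 = x ∧ ∀ t, HasDerivAt γ (v (γ t)) t := by
  have key : ∀ n : ℕ, ∃ α : ℝ → E, α 0 = x ∧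
      ∀ t ∈ Icc (-(n + 1) : ℝ) (n + 1),
        HasDerivWithinAt α (v (α t)) (Icc (-(n + 1) : ℝ) (n + 1)) t := by
    intro n
    have h0 : (0 : ℝ) ∈ Icc (-(n + 1) : ℝ) (n + 1) := by
      constructor <;> linarith [n.cast_nonneg (α := ℝ)]
    have hp : IsPicardLindelof (fun _ ↦ v) (⟨0, h0⟩ : Icc (-(n + 1) : ℝ) (n + 1)) x
        (L * (n + 1)) 0 L K :=
      .of_time_independent (fun y _ ↦ hL y) hv.lipschitzOnWith (by simp)
    exact hp.exists_eq_forall_mem_Icc_hasDerivWithinAt₀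
  choose α hα0 hα using key
  have hderiv : ∀ n : ℕ, ∀ t : ℝ, |t| < n + 1 → HasDerivAt (α n) (v (α n t)) t := fun n t ht ↦
    (hα n t ⟨(abs_lt.1 ht).1.le, (abs_lt.1 ht).2.le⟩).hasDerivAt
      (Icc_mem_nhds (abs_lt.1 ht).1 (abs_lt.1 ht).2)
  have heq : ∀ n m : ℕ, n ≤ m → ∀ t : ℝ, |t| < n + 1 → α n t = α m t := by
    intro n m hnm t ht
    have hnm' : (n : ℝ) ≤ m := by exact_mod_cast hnm
    refine ODE_solution_unique_of_mem_Ioo (v := fun _ ↦ v) (s := fun _ ↦ univ) (K := K)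
      (a := -(n + 1)) (b := n + 1) (t₀ := 0) (fun _ _ ↦ hv.lipschitzOnWith)
      (by constructor <;> linarith [n.cast_nonneg (α := ℝ)])
      (fun s hs ↦ ⟨hderiv n s (abs_lt.2 hs), mem_univ _⟩)
      (fun s hs ↦ ⟨hderiv m s ((abs_lt.2 hs).trans_le (by linarith)), mem_univ _⟩)
      ((hα0 n).trans (hα0 m).symm) (abs_lt.1 ht)
  refine ⟨fun t ↦ α ⌈|t|⌉₊ t, by simp [hα0], fun t ↦ ?_⟩
  have ht : |t| < (⌈|t|⌉₊ : ℝ) + 1 := (Nat.le_ceil _).trans_lt (lt_add_one _)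
  set n := ⌈|t|⌉₊ + 1 with hn
  have hev : (fun s ↦ α ⌈|s|⌉₊ s) =ᶠ[𝓝 t] α n := by
    filter_upwards [continuous_abs.continuousAt.eventually (gt_mem_nhds ht)] with s hs
    refine heq _ _ (Nat.ceil_le.2 ?_) s ((Nat.le_ceil _).trans_lt (lt_add_one _))
    rw [hn]; push_cast; exact hs.le
  refine HasDerivAt.congr_of_eventuallyEq ?_ hev
  change HasDerivAt _ (v (α ⌈|t|⌉₊ t)) t
  rw [show α ⌈|t|⌉₊ t = α n t from hev.eq_of_nhds]
  exact hderiv n t (ht.trans_le (by rw [hn]; push_cast; linarith))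

/-- A left inverse of a smooth map on a neighbourhood of a point with invertible derivative
is smooth at the image point, and the image of the neighbourhood is a neighbourhood. -/
theorem ContDiffAt.image_mem_nhds_and_leftInverse {E F : Type*} [NormedAddCommGroup E]
    [NormedSpace ℝ E] [CompleteSpace E] [NormedAddCommGroup F] [NormedSpace ℝ F]
    {f : E → F} {g : F → E} {W : Set E} {a : E} {f' : E ≃L[ℝ] F} {n : WithTop ℕ∞} (hn : n ≠ 0)
    (hf : ContDiffAt ℝ n f a) (hf' : HasFDerivAt f (f' : E →L[ℝ] F) a) (hW : W ∈ 𝓝 a)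
    (hg : ∀ w ∈ W, g (f w) = w) : f '' W ∈ 𝓝 (f a) ∧ ContDiffAt ℝ n g (f a) := by
  have hs := hf.hasStrictFDerivAt' hf' hn
  refine ⟨by rw [← hs.map_nhds_eq_of_equiv]; exact image_mem_map hW, ?_⟩
  refine (hf.to_localInverse hf' hn).congr_of_eventuallyEq ?_
  filter_upwards [hs.eventually_right_inverse, hs.localInverse_tendsto hW] with y hy hyW
  change g y = hs.localInverse f f' a y
  conv_lhs => rw [← hy]
  exact hg _ hyW

/-- The linear endomorphism of `ℝ²` with matrix `!![a, b; c, d]`. -/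
def planeMap (a b c d : ℝ) : ℝ × ℝ →L[ℝ] ℝ × ℝ :=
  (a • ContinuousLinearMap.fst ℝ ℝ ℝ + b • ContinuousLinearMap.snd ℝ ℝ ℝ).prod
    (c • ContinuousLinearMap.fst ℝ ℝ ℝ + d • ContinuousLinearMap.snd ℝ ℝ ℝ)

@[simp]
theorem planeMap_apply (a b c d : ℝ) (p : ℝ × ℝ) :
    planeMap a b c d p = (a * p.1 + b * p.2, c * p.1 + d * p.2) := by
  simp [planeMap]

theorem exists_equiv_eq_planeMap {a b c d : ℝ} (h : a * d - b * c ≠ 0) :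
    ∃ e : (ℝ × ℝ) ≃L[ℝ] (ℝ × ℝ), (e : ℝ × ℝ →L[ℝ] ℝ × ℝ) = planeMap a b c d := by
  set D := a * d - b * c with hD
  refine ⟨.equivOfInverse (planeMap a b c d) (planeMap (d / D) (-b / D) (-c / D) (a / D))
    (fun p ↦ ?_) fun p ↦ ?_, rfl⟩ <;> ext <;> simp <;> field_simp <;> rw [hD] <;> ring

section Kepler

theorem strictMono_add_mul_sin {k : ℝ} (hk : |k| < 1) :
    StrictMono fun α ↦ α + k * Real.sin α := by
  refine strictMono_of_deriv_pos fun α ↦ ?_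
  have h : HasDerivAt (fun α ↦ α + k * Real.sin α) (1 + k * Real.cos α) α :=
    (hasDerivAt_id α).add ((Real.hasDerivAt_sin α).const_mul k)
  rw [h.deriv]
  have h1 : |k * Real.cos α| ≤ |k| := by
    rw [abs_mul]
    exact mul_le_of_le_one_right (abs_nonneg _) (Real.abs_cos_le_one α)
  linarith [(abs_le.1 h1).1]

theorem abs_add_mul_sin_lt_pi_iff {k : ℝ} (hk : |k| < 1) (α : ℝ) :
    |α + k * Real.sin α| < Real.pi ↔ |α| < Real.pi := by
  have h1 := (strictMono_add_mul_sin hk).lt_iff_lt (a := α) (b := Real.pi)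
  have h2 := (strictMono_add_mul_sin hk).lt_iff_lt (a := -Real.pi) (b := α)
  simp only [Real.sin_neg, Real.sin_pi, mul_zero, neg_zero, add_zero] at h1 h2
  rw [abs_lt, abs_lt, h1, h2]

/-- Smooth solvability of Kepler's equation `α + k(s) sin α = z`. -/
theorem exists_contDiff_kepler {k : ℝ → ℝ} (hk : ContDiff ℝ ∞ k) (hk1 : ∀ s, |k s| < 1) :
    ∃ A : ℝ × ℝ → ℝ, ContDiff ℝ ∞ A ∧ (∀ s z, A (s, z) + k s * Real.sin (A (s, z)) = z) ∧
      ∀ s α, A (s, α + k s * Real.sin α) = α := by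
  have hsurj : ∀ q : ℝ × ℝ, ∃ α, α + k q.1 * Real.sin α = q.2 := by
    rintro ⟨s, z⟩
    have hb : ∀ α, |k s * Real.sin α| ≤ 1 := fun α ↦ by
      rw [abs_mul]
      exact mul_le_one₀ (hk1 s).le (abs_nonneg _) (Real.abs_sin_le_one α)
    refine (Continuous.surjective (f := fun α ↦ α + k s * Real.sin α) (by fun_prop) ?_ ?_) z
    · refine tendsto_atTop_mono (f := fun α : ℝ ↦ α + -1) (fun α ↦ ?_)
        (tendsto_atTop_add_const_right _ _ tendsto_id)
      linarith [(abs_le.1 (hb α)).1]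
    · refine tendsto_atBot_mono (f := fun α : ℝ ↦ α + 1) (fun α ↦ ?_)
        (tendsto_atBot_add_const_right _ _ tendsto_id)
      linarith [(abs_le.1 (hb α)).2]
  choose A hA using hsurj
  have hleft : ∀ s α, A (s, α + k s * Real.sin α) = α := fun s α ↦
    (strictMono_add_mul_sin (hk1 s)).injective (hA (s, _))
  refine ⟨A, contDiff_iff_contDiffAt.2 fun q ↦ ?_, fun s z ↦ hA (s, z), hleft⟩
  set T : ℝ × ℝ → ℝ × ℝ := fun w ↦ (w.1, w.2 + k w.1 * Real.sin w.2) with hT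
  set G : ℝ × ℝ → ℝ × ℝ := fun w ↦ (w.1, A w) with hG
  have hTG : T (G q) = q := by simp [hT, hG, hA]
  have hTs : ContDiff ℝ ∞ T := by
    have := Real.contDiff_sin (n := ∞)
    fun_prop
  have hkd : HasDerivAt k (deriv k (G q).1) (G q).1 :=
    (hk.differentiable (by simp) _).hasDerivAt
  have hd : HasFDerivAt T (planeMap 1 0 (deriv k (G q).1 * Real.sin (G q).2)
      (1 + k (G q).1 * Real.cos (G q).2)) (G q) := by
    have h := hasFDerivAt_fst (𝕜 := ℝ) (p := G q) |>.prodMk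
      ((hasFDerivAt_snd (𝕜 := ℝ) (p := G q)).add
        ((hkd.comp_hasFDerivAt (G q) hasFDerivAt_fst).mul
          ((Real.hasDerivAt_sin _).comp_hasFDerivAt (G q) hasFDerivAt_snd)))
    refine h.congr_fderiv ?_
    ext <;> simp [mul_comm]
  have hne : (1 : ℝ) * (1 + k (G q).1 * Real.cos (G q).2) -
      0 * (deriv k (G q).1 * Real.sin (G q).2) ≠ 0 := by
    have h1 : |k (G q).1 * Real.cos (G q).2| ≤ |k (G q).1| := by
      rw [abs_mul]
      exact mul_le_of_le_one_right (abs_nonneg _) (Real.abs_cos_le_one _)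
    have := (abs_le.1 h1).1
    have := hk1 (G q).1
    apply ne_of_gt
    linarith
  obtain ⟨e, he⟩ := exists_equiv_eq_planeMap hne
  rw [← he] at hd
  have := (ContDiffAt.image_mem_nhds_and_leftInverse (n := ∞) (g := G) (by simp) hTs.contDiffAt
    hd univ_mem (fun w _ ↦ by simp [hT, hG, hleft])).2
  rw [hTG] at this
  exact this.snd

end Kepler

/-- A smooth profile: the circles of radius `s` centered at `(-m s, 0)` are nested, concentric
for `s ≥ R`, and shrink to a point outside the closed unit disc. Here `m' = -k`. -/
structure IsCircleProfile (m k : ℝ → ℝ) (R : ℝ) : Prop where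
  contDiff : ContDiff ℝ ∞ k
  hasDerivAt : ∀ s, HasDerivAt m (-(k s)) s
  nonneg : ∀ s, 0 ≤ k s
  lt_one : ∀ s, k s < 1
  eq_zero : ∀ s, R ≤ s → m s = 0
  one_lt : 1 < m 0

theorem exists_isCircleProfile {R : ℝ} (hR : 1 < R) : ∃ m k, IsCircleProfile m k R := by
  set r := (1 + R) / 2 with hr
  have hr1 : 1 < r := by rw [hr]; linarith
  have hrR : r < R := by rw [hr]; linarith
  set a := 2 / (r + 1) with ha
  have ha0 : 0 < a := by positivity
  have ha1 : a < 1 := by rw [ha, div_lt_one (by positivity)]; linarith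
  have har : 1 < a * r := by rw [ha, div_mul_eq_mul_div, one_lt_div (by positivity)]; linarith
  set k : ℝ → ℝ := fun s ↦ a * Real.smoothTransition ((R - s) / (R - r)) with hk
  have hks : ContDiff ℝ ∞ k := by
    have := Real.smoothTransition.contDiff (n := ⊤)
    exact contDiff_const.mul (this.comp ((contDiff_const.sub contDiff_id).div_const _))
  have hk0 : ∀ s, 0 ≤ k s := fun s ↦ mul_nonneg ha0.le (Real.smoothTransition.nonneg _)
  have hk1 : ∀ s, k s < 1 := fun s ↦
    (mul_le_of_le_one_right ha0.le (Real.smoothTransition.le_one _)).trans_lt ha1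
  have hkz : ∀ s, R ≤ s → k s = 0 := fun s hs ↦ by
    rw [hk]
    simp only
    rw [Real.smoothTransition.zero_of_nonpos, mul_zero]
    exact div_nonpos_of_nonpos_of_nonneg (by linarith) (by linarith)
  have hka : ∀ s, s ≤ r → k s = a := fun s hs ↦ by
    rw [hk]
    simp only
    rw [Real.smoothTransition.one_of_one_le, mul_one]
    rw [one_le_div (by linarith)]
    linarith
  have hii : ∀ x y, IntervalIntegrable k MeasureTheory.volume x y := fun x y ↦
    hks.continuous.intervalIntegrable _ _
  refine ⟨fun s ↦ ∫ u in s..R, k u, k, hks, fun s ↦ ?_, hk0, hk1, fun s hs ↦ ?_, ?_⟩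
  · exact intervalIntegral.integral_hasDerivAt_left (hii _ _)
      (hks.continuous.stronglyMeasurableAtFilter _ _) hks.continuous.continuousAt
  · rw [intervalIntegral.integral_symm, intervalIntegral.integral_congr (g := fun _ ↦ 0)]
    · simp
    · intro u hu
      rw [uIcc_of_le hs] at hu
      exact hkz u hu.1
  · have h1 : ∫ u in (0 : ℝ)..r, k u = a * r := by
      rw [intervalIntegral.integral_congr (g := fun _ ↦ a)]
      · simp [mul_comm]
      · intro u hu
        rw [uIcc_of_le (by linarith)] at hu
        exact hka u hu.2
    have h2 : 0 ≤ ∫ u in r..R, k u := intervalIntegral.integral_nonneg hrR.le fun u _ ↦ hk0 u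
    rw [← intervalIntegral.integral_add_adjacent_intervals (hii 0 r) (hii r R)]
    linarith

/-- Polar coordinates adapted to the circles of radius `s` centered at `(-m s, 0)`. -/
def circleCoord (m : ℝ → ℝ) (w : ℝ × ℝ) : ℝ × ℝ :=
  (w.1 * Real.cos w.2 - m w.1, w.1 * Real.sin w.2)

namespace IsCircleProfile

variable {m k : ℝ → ℝ} {R : ℝ}

theorem abs_lt_one (h : IsCircleProfile m k R) (s : ℝ) : |k s| < 1 := by
  rw [abs_of_nonneg (h.nonneg s)]
  exact h.lt_one s

theorem contDiff_center (h : IsCircleProfile m k R) : ContDiff ℝ ∞ m := by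
  rw [contDiff_infty_iff_deriv]
  exact ⟨fun s ↦ (h.hasDerivAt s).differentiableAt,
    (funext fun s ↦ (h.hasDerivAt s).deriv : deriv m = _) ▸ h.contDiff.neg⟩

theorem strictMono_add (h : IsCircleProfile m k R) : StrictMono fun s ↦ s + m s := by
  refine strictMono_of_deriv_pos fun s ↦ ?_
  have hd : HasDerivAt (fun s ↦ s + m s) (1 + -k s) s := (hasDerivAt_id s).add (h.hasDerivAt s)
  rw [hd.deriv]
  linarith [h.lt_one s]

theorem antitone (h : IsCircleProfile m k R) : Antitone m :=
  antitone_of_hasDerivAt_nonpos h.hasDerivAt fun s ↦ neg_nonpos.2 (h.nonneg s)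

theorem center_nonneg (h : IsCircleProfile m k R) (s : ℝ) : 0 ≤ m s := by
  rw [← h.eq_zero _ (le_max_right s R)]
  exact h.antitone (le_max_left s R)

theorem abs_center_sub_lt (h : IsCircleProfile m k R) {s s' : ℝ} (hs : s < s') :
    |m s - m s'| < |s - s'| := by
  have h1 := h.strictMono_add hs
  have h2 := h.antitone hs.le
  simp only at h1
  rw [abs_of_nonneg (by linarith), abs_of_neg (by linarith)]
  linarith

theorem contDiff_circleCoord (h : IsCircleProfile m k R) : ContDiff ℝ ∞ (circleCoord m) := by
  have := Real.contDiff_sin (n := ∞)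
  have := Real.contDiff_cos (n := ∞)
  have := h.contDiff_center
  unfold circleCoord
  fun_prop

theorem hasFDerivAt_circleCoord (h : IsCircleProfile m k R) (w : ℝ × ℝ) :
    HasFDerivAt (circleCoord m) (planeMap (Real.cos w.2 + k w.1) (-(w.1 * Real.sin w.2))
      (Real.sin w.2) (w.1 * Real.cos w.2)) w := by
  have hd := (((hasFDerivAt_fst (𝕜 := ℝ) (p := w)).mul
      ((Real.hasDerivAt_cos _).comp_hasFDerivAt w hasFDerivAt_snd)).sub
        ((h.hasDerivAt w.1).comp_hasFDerivAt w hasFDerivAt_fst)).prodMk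
      ((hasFDerivAt_fst (𝕜 := ℝ) (p := w)).mul
        ((Real.hasDerivAt_sin _).comp_hasFDerivAt w hasFDerivAt_snd))
  refine hd.congr_fderiv ?_
  ext <;> simp [mul_comm]

theorem one_add_mul_cos_pos (h : IsCircleProfile m k R) (s α : ℝ) :
    0 < 1 + k s * Real.cos α := by
  nlinarith [h.nonneg s, h.lt_one s, Real.neg_one_le_cos α]

theorem injOn_circleCoord (h : IsCircleProfile m k R) :
    InjOn (circleCoord m) {w | 0 < w.1 ∧ |w.2| < Real.pi} := by
  rintro ⟨s, α⟩ ⟨hs, hα⟩ ⟨s', α'⟩ ⟨hs', hα'⟩ heq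
  simp only [circleCoord, Prod.mk.injEq] at heq hs hα hs' hα'
  have hss : s = s' := by
    by_contra hne
    have hlt : |m s - m s'| < |s - s'| := by
      rcases lt_or_gt_of_ne hne with hl | hl
      · exact h.abs_center_sub_lt hl
      · rw [abs_sub_comm, abs_sub_comm s]; exact h.abs_center_sub_lt hl
    have h1 := sq_lt_sq.2 hlt
    have h2 : m s - m s' = s * Real.cos α - s' * Real.cos α' := by linarith [heq.1]
    have h3 : (m s - m s') ^ 2 = s ^ 2 + s' ^ 2 - 2 * s * s' * Real.cos (α - α') := by
      rw [h2, Real.cos_sub]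
      linear_combination s ^ 2 * Real.sin_sq_add_cos_sq α + s' ^ 2 * Real.sin_sq_add_cos_sq α'
        - (s * Real.sin α - s' * Real.sin α') * heq.2
    nlinarith [Real.cos_le_one (α - α'), mul_pos hs hs']
  subst hss
  refine polarCoord.symm.injOn (x₁ := (s, α)) (x₂ := (s, α')) ?_ ?_ ?_
  · exact ⟨hs, abs_lt.1 hα⟩
  · exact ⟨hs, abs_lt.1 hα'⟩
  · simp only [polarCoord_symm_apply, Prod.mk.injEq]
    exact ⟨by linarith [heq.1], heq.2⟩

theorem circleCoord_normSq_of_le (h : IsCircleProfile m k R) {w : ℝ × ℝ} (hw : R ≤ w.1) :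
    (circleCoord m w).1 ^ 2 + (circleCoord m w).2 ^ 2 = w.1 ^ 2 := by
  simp only [circleCoord, h.eq_zero _ hw]
  linear_combination w.1 ^ 2 * Real.sin_sq_add_cos_sq w.2

theorem circleCoord_normSq_le (h : IsCircleProfile m k R) {w : ℝ × ℝ} (hw : 0 < w.1) :
    (circleCoord m w).1 ^ 2 + (circleCoord m w).2 ^ 2 ≤ max (R ^ 2) (w.1 ^ 2) := by
  rcases le_total R w.1 with hR | hR
  · rw [h.circleCoord_normSq_of_le hR]
    exact le_max_right _ _
  · refine le_max_of_le_left ?_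
    have h1 := h.strictMono_add.monotone hR
    simp only [h.eq_zero R le_rfl, add_zero] at h1
    have h2 : (circleCoord m w).1 ^ 2 + (circleCoord m w).2 ^ 2 =
        w.1 ^ 2 + m w.1 ^ 2 - 2 * w.1 * m w.1 * Real.cos w.2 := by
      simp only [circleCoord]
      linear_combination w.1 ^ 2 * Real.sin_sq_add_cos_sq w.2
    have h3 := mul_nonneg hw.le (h.center_nonneg w.1)
    nlinarith [Real.neg_one_le_cos w.2, h.center_nonneg w.1]

theorem closedDisc_subset (h : IsCircleProfile m k R) (hR : 1 < R) :
    closedDisc 1 ⊆ circleCoord m '' {w | 0 < w.1 ∧ |w.2| < Real.pi ∧ w.1 < R} := by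
  rintro ⟨x, y⟩ hp
  simp only [closedDisc, mem_ofPred_eq, one_pow] at hp
  have hx : |x| ≤ 1 := abs_le_one_iff_mul_self_le_one.2 (by nlinarith)
  have hc : Continuous m := h.contDiff_center.continuous
  obtain ⟨s, ⟨hs0, hsR⟩, hs⟩ : (0 : ℝ) ∈ (fun s ↦ s ^ 2 - ((x + m s) ^ 2 + y ^ 2)) '' Ioo 0 R := by
    refine intermediate_value_Ioo (by linarith) (by fun_prop) ⟨?_, ?_⟩
    · have : 0 < x + m 0 := by linarith [(abs_le.1 hx).1, h.one_lt]
      nlinarith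
    · simp only [h.eq_zero R le_rfl]
      nlinarith
  simp only at hs
  have hmem : (x + m s, y) ∈ polarCoord.source := by
    rw [polarCoord_source]
    by_contra hcon
    simp only [mem_union, mem_ofPred_eq, not_or, not_lt, not_not, ne_eq] at hcon
    obtain ⟨h1, rfl⟩ := hcon
    have h2 : x + m s = -s := by
      have : (s - (x + m s)) * (s + (x + m s)) = 0 := by linear_combination hs
      rcases mul_eq_zero.1 this with h3 | h3 <;> linarith
    have h3 := h.strictMono_add hs0
    simp only [zero_add] at h3
    linarith [(abs_le.1 hx).1, h.one_lt]
  have ht := polarCoord.map_source hmem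
  have hinv := polarCoord.left_inv hmem
  have hfst : (polarCoord (x + m s, y)).1 = s := by
    rw [polarCoord_apply]
    simp only
    rw [show (x + m s) ^ 2 + y ^ 2 = s ^ 2 by linarith, Real.sqrt_sq hs0.le]
  rw [polarCoord_target] at ht
  refine ⟨polarCoord (x + m s, y), ⟨ht.1, abs_lt.2 ht.2, hfst.trans_lt hsR⟩, ?_⟩
  rw [polarCoord_symm_apply, Prod.mk.injEq] at hinv
  rw [circleCoord, Prod.mk.injEq, hinv.1, hinv.2, hfst]
  simp

end IsCircleProfile

/-- Cutting off a positive Hamiltonian defined near the trajectories of a compact set. -/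
theorem exists_hamFlow_extending {U : Set (ℝ × ℝ)} {h : ℝ × ℝ → ℝ} {C : ℝ}
    {γ : ℝ → ℝ × ℝ → ℝ × ℝ} {B : Set (ℝ × ℝ)} (hU : IsOpen U) (hUb : Bornology.IsBounded U)
    (hC : 0 < C) (hh : ∀ p ∈ U, ContDiffAt ℝ ∞ h p) (hh0 : ∀ p ∈ U, 0 ≤ h p)
    (hhC : ∀ p ∈ U, h p < C) (hB : IsCompact B)
    (hγ : ContinuousOn (fun q : ℝ × ℝ × ℝ ↦ γ q.1 q.2) (Icc 0 1 ×ˢ B))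
    (hγU : ∀ t ∈ Icc (0 : ℝ) 1, ∀ p ∈ B, γ t p ∈ U) (hγ0 : ∀ p ∈ B, γ 0 p = p)
    (hγd : ∀ p ∈ B, ∀ t ∈ Icc (0 : ℝ) 1, HasDerivAt (fun s ↦ γ s p) (hamVF h (γ t p)) t) :
    ∃ (H : ℝ × ℝ → ℝ) (φ : ℝ → ℝ × ℝ → ℝ × ℝ),
      ContDiff ℝ ∞ H ∧ (∀ p, 0 ≤ H p) ∧ Function.support H ⊆ U ∧ (∀ p, H p < C) ∧
      IsHamFlow H φ ∧ ∀ t ∈ Icc (0 : ℝ) 1, ∀ p ∈ B, φ t p = γ t p := by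
  set Q := (fun q : ℝ × ℝ × ℝ ↦ γ q.1 q.2) '' (Icc 0 1 ×ˢ B) with hQ
  have hQc : IsCompact Q := (isCompact_Icc.prod hB).image_of_continuousOn hγ
  have hQU : Q ⊆ U := by
    rintro _ ⟨q, hq, rfl⟩
    exact hγU _ hq.1 _ hq.2
  obtain ⟨β, hβ0, hβ1, hβ⟩ := exists_contMDiffMap_zero_one_nhds_of_isClosed (n := ⊤)
    𝓘(ℝ, ℝ × ℝ) hU.isClosed_compl hQc.isClosed (disjoint_compl_left_iff_subset.2 hQU)
  have hβs : ContDiff ℝ ∞ β := β.contMDiff.contDiff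
  have hβ0' : ∀ p ∉ U, β p = 0 := fun p hp ↦ hβ0.self_of_nhdsSet p hp
  set H : ℝ × ℝ → ℝ := fun p ↦ β p * h p with hH
  have hHs : ContDiff ℝ ∞ H := contDiff_iff_contDiffAt.2 fun p ↦ by
    by_cases hp : p ∈ U
    · exact hβs.contDiffAt.mul (hh p hp)
    · refine contDiffAt_const (c := (0 : ℝ)) |>.congr_of_eventuallyEq ?_
      filter_upwards [eventually_nhdsSet_iff_forall.1 hβ0 p hp] with q hq
      simp [hH, hq]
  have hsupp : Function.support H ⊆ U := fun p hp ↦ by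
    by_contra hpU
    exact hp (by simp [hH, hβ0' p hpU])
  have hcs : HasCompactSupport H := (hUb.subset hsupp).isCompact_closure
  have hfc : HasCompactSupport (fderiv ℝ H) := hcs.fderiv ℝ
  have hfs : ContDiff ℝ ∞ (fderiv ℝ H) := hHs.fderiv_right (by simp)
  have hvs : ContDiff ℝ ∞ (hamVF H) := by
    unfold hamVF
    exact (hfs.clm_apply contDiff_const).neg.prodMk (hfs.clm_apply contDiff_const)
  have hvc : HasCompactSupport (hamVF H) := by
    refine hfc.comp_left (g := fun L : ℝ × ℝ →L[ℝ] ℝ ↦ (-(L (0, 1)), L (1, 0))) ?_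
    simp
  obtain ⟨K, hK⟩ := hvs.lipschitzWith_of_hasCompactSupport hvc (by simp)
  obtain ⟨L, hL⟩ := hvc.exists_bound_of_continuous hvs.continuous
  have hL0 : 0 ≤ L := (norm_nonneg _).trans (hL 0)
  choose φ hφ0 hφ using exists_global_integralCurve (L := ⟨L, hL0⟩) hK hL
  refine ⟨H, fun t p ↦ φ p t, hHs, fun p ↦ ?_, hsupp, fun p ↦ ?_, ⟨hφ0, hφ⟩, fun t ht p hp ↦ ?_⟩
  · by_cases hp : p ∈ U
    · exact mul_nonneg (hβ p).1 (hh0 p hp)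
    · simp [hH, hβ0' p hp]
  · by_cases hp : p ∈ U
    · exact (mul_le_of_le_one_left (hh0 p hp) (hβ p).2).trans_lt (hhC p hp)
    · simpa [hH, hβ0' p hp] using hC
  · have hd : ∀ t ∈ Icc (0 : ℝ) 1, HasDerivAt (fun s ↦ γ s p) (hamVF H (γ t p)) t := fun t ht ↦ by
      have hmem : γ t p ∈ Q := ⟨(t, p), ⟨ht, hp⟩, rfl⟩
      have hev : H =ᶠ[𝓝 (γ t p)] h := by
        filter_upwards [eventually_nhdsSet_iff_forall.1 hβ1 _ hmem] with q hq
        simp [hH, hq]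
      have := hγd p hp t ht
      rwa [hamVF, ← hev.fderiv_eq] at this
    refine ODE_solution_unique (v := fun _ ↦ hamVF H) (K := K) (fun _ ↦ hK)
      (fun s _ ↦ (hφ p s).continuousAt.continuousWithinAt)
      (fun s _ ↦ (hφ p s).hasDerivWithinAt)
      (fun s hs ↦ (hd s hs).continuousAt.continuousWithinAt)
      (fun s hs ↦ (hd s (Ico_subset_Icc_self hs)).hasDerivWithinAt) ?_ ht
    simp only [hφ0, hγ0 p hp]

/-- If `h ∘ F = c (π/2 - y)` with `det DF = 2 s ∂y/∂α`, a curve on which `y` is constant and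
`s²` grows at rate `c` is mapped by `F` to a trajectory of `h`. -/
theorem hamVF_eq_of_comp {h : ℝ × ℝ → ℝ} {F : ℝ × ℝ → ℝ × ℝ} {y : ℝ × ℝ → ℝ} {w : ℝ × ℝ}
    {a b a' b' ys yα s' α' c : ℝ} (hh : DifferentiableAt ℝ h (F w))
    (hF : HasFDerivAt F (planeMap a b a' b') w)
    (hy : HasFDerivAt y (ys • ContinuousLinearMap.fst ℝ ℝ ℝ +
      yα • ContinuousLinearMap.snd ℝ ℝ ℝ) w)
    (hcomp : h ∘ F =ᶠ[𝓝 w] fun w ↦ c * (Real.pi / 2 - y w))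
    (hdet : a * b' - b * a' = 2 * w.1 * yα) (hyα : yα ≠ 0) (hw : w.1 ≠ 0)
    (hs : 2 * w.1 * s' = c) (hα : ys * s' + yα * α' = 0) :
    planeMap a b a' b' (s', α') = hamVF h (F w) := by
  have h1 := (hh.hasFDerivAt.comp w hF).unique
    (((hy.const_sub (Real.pi / 2)).const_mul c).congr_of_eventuallyEq hcomp)
  have hlin : ∀ u v : ℝ, fderiv ℝ h (F w) (u, v) =
      u * fderiv ℝ h (F w) (1, 0) + v * fderiv ℝ h (F w) (0, 1) := fun u v ↦ by
    rw [← smul_eq_mul, ← smul_eq_mul, ← map_smul, ← map_smul, ← map_add]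
    simp
  have e1 := congrArg (fun L ↦ L (1, 0)) h1
  have e2 := congrArg (fun L ↦ L (0, 1)) h1
  simp [hlin a a', hlin b b'] at e1 e2
  have hne : 2 * w.1 * yα ≠ 0 := mul_ne_zero (mul_ne_zero two_ne_zero hw) hyα
  rw [planeMap_apply, hamVF]
  refine Prod.ext (mul_left_cancel₀ hne ?_) (mul_left_cancel₀ hne ?_)
  · linear_combination (a * yα - b * ys) * hs + 2 * w.1 * b * hα
      - fderiv ℝ h (F w) (0, 1) * hdet + a * e2 - b * e1
  · linear_combination (a' * yα - b' * ys) * hs + 2 * w.1 * b' * hα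
      + fderiv ℝ h (F w) (1, 0) * hdet - b' * e1 + a' * e2

theorem exists_pushing_hamiltonian (δ : ℝ) (hδ : 0 < δ) :
    ∃ (H : ℝ × ℝ → ℝ) (φ : ℝ → ℝ × ℝ → ℝ × ℝ),
      ContDiff ℝ (⊤ : ℕ∞) H ∧ (∀ p, 0 ≤ H p) ∧
      Function.support H ⊆ {p : ℝ × ℝ | p.1 ^ 2 + p.2 ^ 2 < 2 + 2 * δ} ∧
      (∀ p, H p < Real.pi + δ) ∧
      IsHamFlow H φ ∧
      (∀ t ∈ Set.Icc (0 : ℝ) 1,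
        φ t '' closedDisc 1 ⊆ closedDisc (Real.sqrt ((1 + t) * (1 + δ / Real.pi)))) ∧
      φ 1 '' closedDisc 1 ∩ closedDisc 1 = ∅ := by
  have hπ := Real.pi_gt_three
  set c := 1 + δ / (2 * Real.pi) with hc
  have hδπ : 0 < δ / Real.pi := by positivity
  have hcd : c = 1 + δ / Real.pi / 2 := by rw [hc]; field_simp
  have hc1 : 1 < c := by linarith
  have hδπ' : δ / Real.pi < δ := div_lt_self hδ (by linarith)
  have hcπ : c * Real.pi < Real.pi + δ := by
    rw [hc]; field_simp; nlinarith
  set R := Real.sqrt c with hRdef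
  have hRc : R ^ 2 = c := Real.sq_sqrt (by linarith)
  have hR : 1 < R := by rw [hRdef, Real.lt_sqrt] <;> linarith
  obtain ⟨m, k, h⟩ := exists_isCircleProfile hR
  obtain ⟨A, hA, hAr, hAl⟩ := exists_contDiff_kepler h.contDiff h.abs_lt_one
  set F := circleCoord m with hF
  set W₀ : Set (ℝ × ℝ) := {w | 0 < w.1 ∧ |w.2| < Real.pi} with hW₀
  set W : Set (ℝ × ℝ) := {w | w ∈ W₀ ∧ w.1 ^ 2 < 2 + 2 * δ} with hW
  have hW₀o : IsOpen W₀ := (isOpen_lt continuous_const continuous_fst).inter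
    (isOpen_lt continuous_snd.abs continuous_const)
  have hWo : IsOpen W := hW₀o.inter (isOpen_lt (continuous_fst.pow 2) continuous_const)
  set g := Function.invFunOn F W₀ with hg
  have hgF : ∀ w ∈ W₀, g (F w) = w := h.injOn_circleCoord.leftInvOn_invFunOn
  have hloc : ∀ V ⊆ W₀, ∀ w ∈ V, IsOpen V → F '' V ∈ 𝓝 (F w) ∧ ContDiffAt ℝ ∞ g (F w) := by
    intro V hV w hw hVo
    have hdet : (Real.cos w.2 + k w.1) * (w.1 * Real.cos w.2) -
        -(w.1 * Real.sin w.2) * Real.sin w.2 ≠ 0 := by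
      have := mul_pos (hV hw).1 (h.one_add_mul_cos_pos w.1 w.2)
      refine ne_of_gt (this.trans_eq ?_)
      linear_combination -w.1 * Real.sin_sq_add_cos_sq w.2
    obtain ⟨e, he⟩ := exists_equiv_eq_planeMap hdet
    have hd := h.hasFDerivAt_circleCoord w
    rw [← he] at hd
    exact ContDiffAt.image_mem_nhds_and_leftInverse (by simp) h.contDiff_circleCoord.contDiffAt hd
      (hVo.mem_nhds hw) fun v hv ↦ hgF v (hV hv)
  have hWW₀ : W ⊆ W₀ := fun w hw ↦ hw.1
  set y : ℝ × ℝ → ℝ := fun w ↦ (w.2 + k w.1 * Real.sin w.2) / 2 with hy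
  have hys : ContDiff ℝ ∞ y := by
    have := Real.contDiff_sin (n := ∞)
    have := h.contDiff
    fun_prop
  have hyabs : ∀ w ∈ W₀, |y w| < Real.pi / 2 := fun w hw ↦ by
    have := (abs_add_mul_sin_lt_pi_iff (h.abs_lt_one w.1) w.2).2 hw.2
    rw [hy]
    simp only
    rw [abs_div, abs_two]
    linarith
  have hdisc : ∀ p ∈ closedDisc 1, g p ∈ W₀ ∧ (g p).1 < R ∧ F (g p) = p := fun p hp ↦ by
    obtain ⟨w, hw, rfl⟩ := h.closedDisc_subset hR hp
    rw [← hF, hgF w ⟨hw.1, hw.2.1⟩]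
    exact ⟨⟨hw.1, hw.2.1⟩, hw.2.2, rfl⟩
  set r : ℝ → ℝ × ℝ → ℝ := fun t p ↦ Real.sqrt ((g p).1 ^ 2 + c * t) with hr
  set σ : ℝ → ℝ × ℝ → ℝ × ℝ := fun t p ↦ (r t p, A (r t p, 2 * y (g p))) with hσ
  have hyσ : ∀ t p, y (σ t p) = y (g p) := fun t p ↦ by
    simp only [hσ, hy, hAr]
    ring
  have hσpos : ∀ t ∈ Icc (0 : ℝ) 1, ∀ p ∈ closedDisc 1, 0 < (g p).1 ^ 2 + c * t := by
    intro t ht p hp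
    have h1 := pow_pos (hdisc p hp).1.1 2
    have h2 : 0 ≤ c * t := mul_nonneg (by linarith) ht.1
    linarith
  have hrsq : ∀ t ∈ Icc (0 : ℝ) 1, ∀ p ∈ closedDisc 1, r t p ^ 2 = (g p).1 ^ 2 + c * t :=
    fun t ht p hp ↦ Real.sq_sqrt (hσpos t ht p hp).le
  have hrle : ∀ t ∈ Icc (0 : ℝ) 1, ∀ p ∈ closedDisc 1, r t p ^ 2 ≤ (1 + t) * c := by
    intro t ht p hp
    have h1 := (hdisc p hp).1.1
    have h2 := (hdisc p hp).2.1
    have : (g p).1 ^ 2 ≤ R ^ 2 := by gcongr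
    rw [hrsq t ht p hp]
    linarith
  have hσW : ∀ t ∈ Icc (0 : ℝ) 1, ∀ p ∈ closedDisc 1, σ t p ∈ W := by
    intro t ht p hp
    refine ⟨⟨Real.sqrt_pos.2 (hσpos t ht p hp), ?_⟩, ?_⟩
    · rw [← abs_add_mul_sin_lt_pi_iff (h.abs_lt_one (σ t p).1)]
      simp only [hσ, hAr, abs_mul, abs_two]
      linarith [hyabs _ (hdisc p hp).1]
    · have h1 := hrle t ht p hp
      change r t p ^ 2 < _
      nlinarith [ht.2]
  have hcomp : ∀ w ∈ W₀, (fun p ↦ c * (Real.pi / 2 - y (g p))) ∘ F =ᶠ[𝓝 w]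
      fun w ↦ c * (Real.pi / 2 - y w) := fun w hw ↦ by
    filter_upwards [hW₀o.mem_nhds hw] with v hv
    simp [hgF v hv]
  have hnorm : ∀ w ∈ W, (F w).1 ^ 2 + (F w).2 ^ 2 < 2 + 2 * δ := fun w hw ↦
    (h.circleCoord_normSq_le hw.1.1).trans_lt (max_lt (by linarith) hw.2)
  have hsmooth : ∀ p ∈ F '' W, ContDiffAt ℝ ∞ (fun p ↦ c * (Real.pi / 2 - y (g p))) p := by
    rintro _ ⟨w, hw, rfl⟩
    exact contDiffAt_const.mul (contDiffAt_const.sub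
      (hys.contDiffAt.comp _ (hloc W hWW₀ w hw hWo).2))
  have hderiv : ∀ p ∈ closedDisc 1, ∀ t ∈ Icc (0 : ℝ) 1, HasDerivAt (fun s ↦ F (σ s p))
      (hamVF (fun p ↦ c * (Real.pi / 2 - y (g p))) (F (σ t p))) t := by
    intro p hp t ht
    have hwW := hσW t ht p hp
    have hpos := hσpos t ht p hp
    have hr' : HasDerivAt (fun s ↦ r s p) (c / (2 * r t p)) t := by
      have := (((hasDerivAt_id t).const_mul c).const_add ((g p).1 ^ 2)).sqrt hpos.ne'
      simpa using this
    have hα' : HasDerivAt (fun s ↦ (σ s p).2) (deriv (fun s ↦ (σ s p).2) t) t :=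
      ((hA.differentiable (by simp) _).comp t
        (hr'.differentiableAt.prodMk (differentiableAt_const _))).hasDerivAt
    have hσ' : HasDerivAt (fun s ↦ σ s p) (c / (2 * r t p), deriv (fun s ↦ (σ s p).2) t) t :=
      hr'.prodMk hα'
    have hkd : HasDerivAt k (deriv k (σ t p).1) (σ t p).1 :=
      (h.contDiff.differentiable (by simp) _).hasDerivAt
    have hyd : HasFDerivAt y ((deriv k (σ t p).1 * Real.sin (σ t p).2 / 2) •
        ContinuousLinearMap.fst ℝ ℝ ℝ + ((1 + k (σ t p).1 * Real.cos (σ t p).2) / 2) •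
        ContinuousLinearMap.snd ℝ ℝ ℝ) (σ t p) := by
      have hd := ((hasFDerivAt_snd (𝕜 := ℝ) (p := σ t p)).add
        ((hkd.comp_hasFDerivAt (σ t p) hasFDerivAt_fst).mul
          ((Real.hasDerivAt_sin _).comp_hasFDerivAt (σ t p) hasFDerivAt_snd))).mul_const (1 / 2)
      have hd' := hd.congr_of_eventuallyEq (f₁ := y) (.of_forall fun w ↦ by
        simp [hy, div_eq_mul_inv])
      refine hd'.congr_fderiv ?_
      ext <;> simp <;> ring
    have hconst : deriv k (σ t p).1 * Real.sin (σ t p).2 / 2 * (c / (2 * r t p)) +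
        (1 + k (σ t p).1 * Real.cos (σ t p).2) / 2 * deriv (fun s ↦ (σ s p).2) t = 0 := by
      have h1 := hyd.comp_hasDerivAt t hσ'
      have h2 : y ∘ (fun s ↦ σ s p) = fun _ ↦ y (g p) := funext fun s ↦ hyσ s p
      rw [h2] at h1
      simpa using h1.unique (hasDerivAt_const t (y (g p)))
    have hmain := hamVF_eq_of_comp
      (((hsmooth _ ⟨_, hwW, rfl⟩).differentiableAt (by simp))) (h.hasFDerivAt_circleCoord (σ t p))
      hyd (hcomp _ hwW.1)
      (by linear_combination (σ t p).1 * Real.sin_sq_add_cos_sq (σ t p).2)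
      (by have := h.one_add_mul_cos_pos (σ t p).1 (σ t p).2; positivity) hwW.1.1.ne'
      (by change 2 * r t p * _ = c
          have : r t p ≠ 0 := hwW.1.1.ne'
          field_simp) hconst
    rw [← hmain]
    exact (h.hasFDerivAt_circleCoord (σ t p)).comp_hasDerivAt t hσ'
  have hcont : ContinuousOn (fun q : ℝ × ℝ × ℝ ↦ F (σ q.1 q.2)) (Icc 0 1 ×ˢ closedDisc 1) := by
    have hg' : ContinuousOn (fun q : ℝ × ℝ × ℝ ↦ g q.2) (Icc 0 1 ×ˢ closedDisc 1) := by
      intro q hq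
      have hq' := hdisc q.2 hq.2
      have := (hloc W₀ subset_rfl _ hq'.1 hW₀o).2.continuousAt
      rw [hq'.2.2] at this
      exact (ContinuousAt.comp (x := q) this continuousAt_snd).continuousWithinAt
    have hr' : ContinuousOn (fun q : ℝ × ℝ × ℝ ↦ r q.1 q.2) (Icc 0 1 ×ˢ closedDisc 1) :=
      ((hg'.fst.pow 2).add (continuousOn_const.mul continuousOn_fst)).sqrt
    exact h.contDiff_circleCoord.continuous.comp_continuousOn (hr'.prodMk
      (hA.continuous.comp_continuousOn (hr'.prodMk
        (continuousOn_const.mul (hys.continuous.comp_continuousOn hg')))))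
  have hopen : IsOpen (F '' W) := isOpen_iff_mem_nhds.2 <| by
    rintro _ ⟨w, hw, rfl⟩
    exact (hloc W hWW₀ w hw hWo).1
  have hsub : ∀ {X : ℝ}, {p : ℝ × ℝ | p.1 ^ 2 + p.2 ^ 2 ≤ X} ⊆
      Metric.closedBall 0 (Real.sqrt X) := fun {X} p hp ↦ by
    rw [mem_closedBall_zero_iff, Prod.norm_def]
    exact max_le (Real.abs_le_sqrt (by nlinarith [sq_nonneg p.2, hp.out]))
      (Real.abs_le_sqrt (by nlinarith [sq_nonneg p.1, hp.out]))
  have hbdd : Bornology.IsBounded (F '' W) := by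
    refine Metric.isBounded_closedBall.subset ((?_ : F '' W ⊆ _).trans (hsub (X := 2 + 2 * δ)))
    rintro _ ⟨w, hw, rfl⟩
    exact (hnorm w hw).le
  have hcomp1 : IsCompact (closedDisc 1) :=
    (isCompact_closedBall _ _).of_isClosed_subset
      (isClosed_le (by fun_prop) continuous_const) hsub
  obtain ⟨H, φ, hHs, hH0, hHsupp, hHC, hφ, hφγ⟩ := exists_hamFlow_extending (C := Real.pi + δ)
    (h := fun p ↦ c * (Real.pi / 2 - y (g p))) (γ := fun t p ↦ F (σ t p)) hopen hbdd
    (by positivity) hsmooth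
    (by
      rintro _ ⟨w, hw, rfl⟩
      rw [hgF w hw.1]
      have := (abs_lt.1 (hyabs w hw.1)).2
      exact mul_nonneg (by linarith) (by linarith))
    (by
      rintro _ ⟨w, hw, rfl⟩
      rw [hgF w hw.1]
      have := (abs_lt.1 (hyabs w hw.1)).1
      nlinarith)
    hcomp1 hcont (fun t ht p hp ↦ ⟨_, hσW t ht p hp, rfl⟩)
    (fun p hp ↦ by
      have h1 := hdisc p hp
      have h2 : r 0 p = (g p).1 := by simp [hr, Real.sqrt_sq h1.1.1.le]
      have h3 : 2 * y (g p) = (g p).2 + k (g p).1 * Real.sin (g p).2 := by simp only [hy]; ring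
      simp only [hσ, h2, h3, hAl]
      exact h1.2.2)
    hderiv
  refine ⟨H, φ, hHs, hH0, hHsupp.trans ?_, hHC, hφ, fun t ht ↦ ?_, ?_⟩
  · rintro _ ⟨w, hw, rfl⟩
    exact hnorm w hw
  · rintro _ ⟨p, hp, rfl⟩
    rw [hφγ t ht p hp]
    simp only [closedDisc, mem_ofPred_eq]
    rw [Real.sq_sqrt (mul_nonneg (by linarith [ht.1]) (by linarith))]
    refine (h.circleCoord_normSq_le (hσW t ht p hp).1.1).trans (max_le ?_ ?_)
    · rw [hRc]
      nlinarith [ht.1]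
    · refine (hrle t ht p hp).trans ?_
      exact mul_le_mul_of_nonneg_left (by linarith) (by linarith [ht.1])
  · rw [eq_empty_iff_forall_notMem]
    rintro _ ⟨⟨p, hp, rfl⟩, hq⟩
    have h1 : (1 : ℝ) ∈ Icc (0 : ℝ) 1 := by simp
    rw [hφγ 1 h1 p hp] at hq
    have h2 := hrsq 1 h1 p hp
    have h3 := pow_pos (hdisc p hp).1.1 2
    have h4 : R ≤ (σ 1 p).1 := Real.sqrt_le_sqrt (by linarith)
    have h5 := h.circleCoord_normSq_of_le h4
    have h6 : (F (σ 1 p)).1 ^ 2 + (F (σ 1 p)).2 ^ 2 ≤ 1 ^ 2 := hq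
    rw [h5] at h6
    change r 1 p ^ 2 ≤ _ at h6
    linarith
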